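/- Let H be a Hilbert space, φ : X → H a map with ‖φ(x)‖ ≤ R for all x, and β : X → [0,b₀] a bounded function. Let x₁,…,x_n be i.i.d. samples from a probability measure p and x′₁,…,x′_m i.i.d. from q, where ∫ f dq = ∫ f·β dp for all integrable f. Then with probability at least 1 − δ, ‖(1/m)Σ_j φ(x′_j) − (1/n)Σ_i β(x_i)φ(x_i)‖ ≤ (1 + √(2 log(2/δ)))·R·√(b₀²/n + 1/m). -/

import Mathlib

open MeasureTheory ProbabilityTheory
open scoped NNReal RealInnerProductSpace

lemma abs_integral_le_of_abs_le {A : Type*} [MeasurableSpace A] {μ : Measure A}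
    [IsProbabilityMeasure μ] {f : A → ℝ} {C : ℝ} (hC : ∀ x, |f x| ≤ C) :
    |∫ x, f x ∂μ| ≤ C := by
  simpa using norm_integral_le_of_norm_le_const (f := f) (C := C) (ae_of_all μ hC)

/-- Tensorization of the sub-Gaussian property over a product of two probability spaces. -/
lemma hasSubgaussianMGF_prod {A B : Type*} [MeasurableSpace A] [MeasurableSpace B]
    {μ : Measure A} {ν : Measure B} [IsProbabilityMeasure μ] [IsProbabilityMeasure ν]
    {f : A × B → ℝ} (hf : Measurable f) {C : ℝ} (hC : ∀ z, |f z| ≤ C) {c₁ c₂ : ℝ≥0}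
    (h₁ : HasSubgaussianMGF (fun x ↦ ∫ y, f (x, y) ∂ν - ∫ x', ∫ y, f (x', y) ∂ν ∂μ) c₁ μ)
    (h₂ : ∀ x, HasSubgaussianMGF (fun y ↦ f (x, y) - ∫ y', f (x, y') ∂ν) c₂ ν) :
    HasSubgaussianMGF (fun z ↦ f z - ∫ z', f z' ∂μ.prod ν) (c₁ + c₂) (μ.prod ν) := by
  have hfi : Integrable f (μ.prod ν) :=
    Integrable.of_bound hf.aestronglyMeasurable C (ae_of_all _ hC)
  have hint (t : ℝ) :
      Integrable (fun z ↦ Real.exp (t * (f z - ∫ z', f z' ∂μ.prod ν))) (μ.prod ν) :=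
    integrable_exp_mul_of_mem_Icc (a := -C - ∫ z', f z' ∂μ.prod ν)
      (b := C - ∫ z', f z' ∂μ.prod ν) (by fun_prop) (ae_of_all _ fun z ↦ by
        have := abs_le.1 (hC z)
        constructor <;> linarith)
  refine ⟨hint, fun t ↦ ?_⟩
  rw [mgf, integral_prod _ (hint t), integral_prod f hfi]
  set m := ∫ x', ∫ y, f (x', y) ∂ν ∂μ
  calc ∫ x, ∫ y, Real.exp (t * (f (x, y) - m)) ∂ν ∂μ
      ≤ ∫ x, Real.exp (t * (∫ y, f (x, y) ∂ν - m)) * Real.exp (c₂ * t ^ 2 / 2) ∂μ := by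
        refine integral_mono_of_nonneg (ae_of_all _ fun x ↦ integral_nonneg fun y ↦ by positivity)
          ((h₁.integrable_exp_mul t).mul_const _) (ae_of_all _ fun x ↦ ?_)
        have key (y : B) : Real.exp (t * (f (x, y) - m)) =
            Real.exp (t * (∫ y, f (x, y) ∂ν - m)) *
              Real.exp (t * (f (x, y) - ∫ y, f (x, y) ∂ν)) := by
          rw [← Real.exp_add]
          ring_nf
        simp only [key, integral_const_mul]
        gcongr
        exact (h₂ x).mgf_le t
    _ ≤ Real.exp (c₁ * t ^ 2 / 2) * Real.exp (c₂ * t ^ 2 / 2) := by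
        rw [integral_mul_const]
        gcongr
        exact h₁.mgf_le t
    _ = Real.exp ((c₁ + c₂ : ℝ≥0) * t ^ 2 / 2) := by
        rw [← Real.exp_add]
        push_cast
        ring_nf

/-- Hoeffding's lemma for a function of oscillation at most `c`. -/
lemma hasSubgaussianMGF_of_abs_sub_le {A : Type*} [MeasurableSpace A] {μ : Measure A}
    [IsProbabilityMeasure μ] {g : A → ℝ} (hg : Measurable g) {c : ℝ≥0}
    (hc : ∀ x y, |g x - g y| ≤ c) :
    HasSubgaussianMGF (fun x ↦ g x - ∫ y, g y ∂μ) ((c / 2) ^ 2) μ := by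
  obtain ⟨x₀⟩ : Nonempty A := nonempty_of_isProbabilityMeasure μ
  have : Nonempty A := ⟨x₀⟩
  have hbdd : BddBelow (Set.range g) := by
    refine ⟨g x₀ - c, ?_⟩
    rintro _ ⟨x, rfl⟩
    have := (abs_le.1 (hc x₀ x)).2
    linarith
  have h := hasSubgaussianMGF_of_mem_Icc (μ := μ) (a := ⨅ x, g x) (b := (⨅ x, g x) + c)
    hg.aemeasurable (ae_of_all _ fun x ↦ ⟨ciInf_le hbdd x, by
      have : g x - c ≤ ⨅ y, g y := le_ciInf fun y ↦ by
        have := (abs_le.1 (hc x y)).2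
        linarith
      linarith⟩)
  simpa using h

/-- **McDiarmid's inequality**: a bounded function of independent variables which changes by at
most `c i` when its `i`-th argument is modified is sub-Gaussian around its mean. -/
lemma hasSubgaussianMGF_pi_of_bounded_differences {X : Type*} [MeasurableSpace X] {n : ℕ}
    (μ : Fin n → Measure X) [∀ i, IsProbabilityMeasure (μ i)] {f : (Fin n → X) → ℝ}
    (hf : Measurable f) {C : ℝ} (hC : ∀ x, |f x| ≤ C) (c : Fin n → ℝ≥0)
    (hc : ∀ i x y, |f (Function.update x i y) - f x| ≤ c i) :
    HasSubgaussianMGF (fun x ↦ f x - ∫ y, f y ∂Measure.pi μ) (∑ i, (c i / 2) ^ 2)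
      (Measure.pi μ) := by
  induction n with
  | zero =>
    have h : (fun x ↦ f x - ∫ y, f y ∂Measure.pi μ) = fun _ ↦ 0 := by
      ext x
      have (y : Fin 0 → X) : f y = f x := congrArg f (Subsingleton.elim _ _)
      simp [this]
    rw [h]
    simp
  | succ n ih =>
    have hmp := measurePreserving_piFinSuccAbove μ 0
    set e := MeasurableEquiv.piFinSuccAbove (fun _ : Fin (n + 1) ↦ X) 0
    have he (x : X) (y : Fin n → X) : e.symm (x, y) = Fin.cons x y := by
      simp [e, MeasurableEquiv.piFinSuccAbove, Fin.consEquiv]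
    set F : X × (Fin n → X) → ℝ := fun z ↦ f (e.symm z)
    have hFm : Measurable F := hf.comp e.symm.measurable
    have hFi (x : X) (ν : Measure (Fin n → X)) [IsProbabilityMeasure ν] :
        Integrable (fun y ↦ F (x, y)) ν :=
      Integrable.of_bound (hFm.comp measurable_prodMk_left).aestronglyMeasurable C
        (ae_of_all _ fun y ↦ hC _)
    have key := hasSubgaussianMGF_prod (μ := μ 0)
      (ν := Measure.pi fun j ↦ μ (Fin.succAbove 0 j)) hFm (fun z ↦ hC _)
      (c₁ := (c 0 / 2) ^ 2) (c₂ := ∑ i : Fin n, (c i.succ / 2) ^ 2) ?_ fun x ↦ ?_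
    · rw [Fin.sum_univ_succ, ← hmp.map_eq] at *
      have h := key.of_map e.measurable.aemeasurable
      rw [integral_map_equiv] at h
      simpa [Function.comp_def, F] using h
    · refine hasSubgaussianMGF_of_abs_sub_le ?_ fun x x' ↦ ?_
      · exact (hFm.stronglyMeasurable.integral_prod_right').measurable
      · rw [← integral_sub (hFi _ _) (hFi _ _)]
        refine abs_integral_le_of_abs_le fun y ↦ ?_
        have := hc 0 (Fin.cons x' y) x
        simpa only [F, he, Fin.update_cons_zero] using this
    · refine ih _ (hFm.comp (by fun_prop)) (fun y ↦ hC _) (fun i ↦ c i.succ) fun i y z ↦ ?_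
      have := hc i.succ (Fin.cons x y) z
      simpa [F, he, Fin.cons_update] using this

/-- Second moment of a sum of two independent square-integrable vectors, one of them
centered. -/
lemma integral_norm_add_sq_prod {H : Type*} [NormedAddCommGroup H] [InnerProductSpace ℝ H]
    [CompleteSpace H] {A B : Type*} [MeasurableSpace A] [MeasurableSpace B]
    {μ : Measure A} {ν : Measure B} [IsProbabilityMeasure μ] [IsProbabilityMeasure ν]
    {a : A → H} {b : B → H} (ha : MemLp a 2 μ) (hb : MemLp b 2 ν) (hb0 : ∫ y, b y ∂ν = 0) :
    ∫ z, ‖a z.1 + b z.2‖ ^ 2 ∂μ.prod ν = ∫ x, ‖a x‖ ^ 2 ∂μ + ∫ y, ‖b y‖ ^ 2 ∂ν := by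
  have ha' : MemLp (fun z : A × B ↦ a z.1) 2 (μ.prod ν) :=
    ha.comp_measurePreserving measurePreserving_fst
  have hb' : MemLp (fun z : A × B ↦ b z.2) 2 (μ.prod ν) :=
    hb.comp_measurePreserving measurePreserving_snd
  have hi : Integrable (fun z : A × B ↦ ⟪a z.1, b z.2⟫) (μ.prod ν) := by
    refine (ha'.norm.integrable_mul hb'.norm).mono
      (ha'.aestronglyMeasurable.inner hb'.aestronglyMeasurable) (ae_of_all _ fun z ↦ ?_)
    simpa using norm_inner_le_norm (𝕜 := ℝ) (a z.1) (b z.2)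
  have h0 : ∫ z, ⟪a z.1, b z.2⟫ ∂μ.prod ν = 0 := by
    rw [integral_prod _ hi]
    simp [integral_inner (hb.integrable one_le_two), hb0]
  have ha2 := ha'.integrable_norm_pow two_ne_zero
  have hb2 := hb'.integrable_norm_pow two_ne_zero
  simp only [norm_add_sq_real]
  rw [integral_add (ha2.fun_add (hi.const_mul 2)) hb2, integral_add ha2 (hi.const_mul 2),
    integral_const_mul, h0, mul_zero, add_zero]
  congr 1
  · simpa using integral_fun_fst (μ := μ) (ν := ν) fun x ↦ ‖a x‖ ^ 2
  · simpa using integral_fun_snd (μ := μ) (ν := ν) fun y ↦ ‖b y‖ ^ 2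

/-- Second moment of a sum of i.i.d. centered square-integrable vectors. -/
lemma integral_norm_sum_sq_pi {H : Type*} [NormedAddCommGroup H] [InnerProductSpace ℝ H]
    [CompleteSpace H] {X : Type*} [MeasurableSpace X] (μ : Measure X) [IsProbabilityMeasure μ]
    {g : X → H} (hg : MemLp g 2 μ) (hg0 : ∫ x, g x ∂μ = 0) (n : ℕ) :
    ∫ x, ‖∑ i, g (x i)‖ ^ 2 ∂(Measure.pi fun _ : Fin n ↦ μ) = n * ∫ x, ‖g x‖ ^ 2 ∂μ := by
  induction n with
  | zero => simp
  | succ n ih =>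
    have hmp := measurePreserving_piFinSuccAbove (fun _ : Fin (n + 1) ↦ μ) 0
    have hev (i : Fin n) : MemLp (fun x : Fin n → X ↦ g (x i)) 2 (Measure.pi fun _ ↦ μ) :=
      hg.comp_measurePreserving (measurePreserving_eval _ i)
    have hs : MemLp (fun x : Fin n → X ↦ ∑ i, g (x i)) 2 (Measure.pi fun _ ↦ μ) :=
      memLp_finsetSum _ fun i _ ↦ hev i
    have hs0 : ∫ x, ∑ i, g (x i) ∂(Measure.pi fun _ : Fin n ↦ μ) = 0 := by
      rw [integral_finsetSum _ fun i _ ↦ (hev i).integrable one_le_two]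
      refine Finset.sum_eq_zero fun i _ ↦ ?_
      rw [integral_comp_eval (μ := fun _ : Fin n ↦ μ) (i := i) hg.aestronglyMeasurable, hg0]
    have h := integral_norm_add_sq_prod hg hs hs0
    rw [ih] at h
    have h' := hmp.integral_comp' (fun z : X × (Fin n → X) ↦ ‖g z.1 + ∑ i, g (z.2 i)‖ ^ 2)
    simp only [Fin.sum_univ_succ]
    refine (Eq.trans ?_ (h'.trans h)).trans (by push_cast; ring)
    rfl

/-- The empirical mean of `n` samples of a vector bounded by `K` has variance at most
`K ^ 2 / n`. -/
lemma integral_norm_mean_sub_sq_le {H : Type*} [NormedAddCommGroup H] [InnerProductSpace ℝ H]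
    [CompleteSpace H] {X : Type*} [MeasurableSpace X] (μ : Measure X) [IsProbabilityMeasure μ]
    {g : X → H} (hg : AEStronglyMeasurable g μ) {K : ℝ} (hK : ∀ x, ‖g x‖ ≤ K)
    {n : ℕ} (hn : 0 < n) :
    ∫ x, ‖(1 / (n : ℝ)) • ∑ i, g (x i) - ∫ y, g y ∂μ‖ ^ 2 ∂(Measure.pi fun _ : Fin n ↦ μ) ≤
      K ^ 2 / n := by
  have hn' : (n : ℝ) ≠ 0 := by positivity
  have hgL : MemLp g 2 μ := MemLp.of_bound hg K (ae_of_all _ hK)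
  have hgi := hgL.integrable one_le_two
  set v := ∫ y, g y ∂μ with hv
  have hcL : MemLp (fun x ↦ g x - v) 2 μ := hgL.sub (memLp_const v)
  have hsum (x : Fin n → X) : ‖(1 / (n : ℝ)) • ∑ i, g (x i) - v‖ ^ 2 =
      (1 / (n : ℝ)) ^ 2 * ‖∑ i, (g (x i) - v)‖ ^ 2 := by
    rw [← mul_pow, ← norm_smul_of_nonneg (by positivity), Finset.sum_sub_distrib, smul_sub]
    simp [← Nat.cast_smul_eq_nsmul ℝ, smul_smul, hn']
  have hvar : ∫ x, ‖g x - v‖ ^ 2 ∂μ ≤ K ^ 2 := by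
    have hi : Integrable (fun x ↦ ⟪g x, v⟫) μ := hgi.inner_const v
    have h2 := hgL.integrable_norm_pow two_ne_zero
    have hiv : ∫ x, ⟪g x, v⟫ ∂μ = ‖v‖ ^ 2 := by
      simp_rw [real_inner_comm v]
      rw [integral_inner hgi, ← hv, real_inner_self_eq_norm_sq]
    have hle : ∫ x, ‖g x‖ ^ 2 ∂μ ≤ K ^ 2 := by
      refine (integral_mono h2 (integrable_const (K ^ 2)) fun x ↦ ?_).trans (by simp)
      exact pow_le_pow_left₀ (norm_nonneg _) (hK x) 2
    simp only [norm_sub_sq_real]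
    rw [integral_add (f := fun x ↦ ‖g x‖ ^ 2 - 2 * ⟪g x, v⟫) (h2.sub (hi.const_mul 2))
      (integrable_const _),
      integral_sub h2 (hi.const_mul 2), integral_const_mul, hiv]
    simp only [integral_const, probReal_univ, one_smul]
    nlinarith [sq_nonneg ‖v‖]
  simp only [hsum]
  rw [integral_const_mul, integral_norm_sum_sq_pi μ hcL (by
    rw [integral_sub hgi (integrable_const _)]; simp [hv])]
  calc (1 / (n : ℝ)) ^ 2 * (n * ∫ x, ‖g x - v‖ ^ 2 ∂μ)
      = (∫ x, ‖g x - v‖ ^ 2 ∂μ) / n := by field_simp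
    _ ≤ K ^ 2 / n := by gcongr

/-- Modifying one of `n` samples moves the empirical mean of a vector bounded by `K` by at most
`2 * K / n`. -/
lemma norm_mean_update_sub_le {H : Type*} [NormedAddCommGroup H] [NormedSpace ℝ H]
    {X : Type*} {g : X → H} {K : ℝ} (hK : ∀ x, ‖g x‖ ≤ K) {n : ℕ} (i : Fin n) (x : Fin n → X)
    (y : X) :
    ‖(1 / (n : ℝ)) • ∑ j, g (Function.update x i y j) - (1 / (n : ℝ)) • ∑ j, g (x j)‖ ≤
      2 * K / n := by
  rw [← smul_sub, ← Finset.sum_sub_distrib, Finset.sum_eq_single i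
    (fun j _ hj ↦ by simp [Function.update_of_ne hj]) (by simp), Function.update_self,
    norm_smul_of_nonneg (by positivity)]
  calc 1 / (n : ℝ) * ‖g y - g (x i)‖ ≤ 1 / (n : ℝ) * (K + K) := by
        gcongr
        exact (norm_sub_le _ _).trans (add_le_add (hK _) (hK _))
    _ = 2 * K / n := by ring

/-- The empirical mean of a vector bounded by `K` is bounded by `K`. -/
lemma norm_mean_le {H : Type*} [NormedAddCommGroup H] [NormedSpace ℝ H]
    {X : Type*} {g : X → H} {K : ℝ} (hK : ∀ x, ‖g x‖ ≤ K) {n : ℕ} (hn : 0 < n)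
    (x : Fin n → X) : ‖(1 / (n : ℝ)) • ∑ j, g (x j)‖ ≤ K := by
  rw [norm_smul_of_nonneg (by positivity)]
  calc 1 / (n : ℝ) * ‖∑ j, g (x j)‖ ≤ 1 / (n : ℝ) * (n * K) := by
        gcongr
        simpa using norm_sum_le_of_le Finset.univ (f := fun j ↦ g (x j)) fun j _ ↦ hK (x j)
    _ = K := by field_simp

section TwoSample

variable {H : Type*} [NormedAddCommGroup H] [InnerProductSpace ℝ H] [SecondCountableTopology H]
  [MeasurableSpace H] [BorelSpace H] {X Y : Type*} [MeasurableSpace X] [MeasurableSpace Y]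
  {μ : Measure X} {ν : Measure Y} [IsProbabilityMeasure μ] [IsProbabilityMeasure ν]
  {g : X → H} {h : Y → H} {K L : ℝ≥0} {n m : ℕ}

/-- The distance between the empirical means of two independent bounded samples is sub-Gaussian
around its expectation. -/
lemma hasSubgaussianMGF_norm_mean_sub_mean (hg : Measurable g) (hh : Measurable h)
    (hK : ∀ x, ‖g x‖ ≤ K) (hL : ∀ y, ‖h y‖ ≤ L) (hn : 0 < n) (hm : 0 < m) :
    let P := (Measure.pi fun _ : Fin n ↦ μ).prod (Measure.pi fun _ : Fin m ↦ ν)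
    let D := fun ω : (Fin n → X) × (Fin m → Y) ↦
      ‖(1 / (m : ℝ)) • ∑ j, h (ω.2 j) - (1 / (n : ℝ)) • ∑ i, g (ω.1 i)‖
    HasSubgaussianMGF (fun ω ↦ D ω - ∫ ω', D ω' ∂P) (K ^ 2 / n + L ^ 2 / m) P := by
  intro P D
  have hD : Measurable D := by fun_prop
  have hC (ω) : |D ω| ≤ L + K := by
    rw [abs_of_nonneg (norm_nonneg _)]
    exact (norm_sub_le _ _).trans (add_le_add (norm_mean_le hL hm _) (norm_mean_le hK hn _))
  have hint (x) : Integrable (fun y ↦ D (x, y)) (Measure.pi fun _ : Fin m ↦ ν) :=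
    Integrable.of_bound (hD.comp measurable_prodMk_left).aestronglyMeasurable (L + K)
      (ae_of_all _ fun y ↦ hC _)
  have hpar (M : ℝ≥0) {k : ℕ} (hk : 0 < k) :
      ∑ _i : Fin k, (2 * M / k / 2) ^ 2 = M ^ 2 / (k : ℝ≥0) := by
    have : (k : ℝ≥0) ≠ 0 := by positivity
    simp only [Finset.sum_const, Finset.card_univ, Fintype.card_fin, nsmul_eq_mul]
    field_simp
  refine hasSubgaussianMGF_prod hD hC ?_ fun x ↦ ?_
  · rw [← hpar K hn]
    refine hasSubgaussianMGF_pi_of_bounded_differences (fun _ ↦ μ)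
      hD.stronglyMeasurable.integral_prod_right'.measurable (C := L + K) (fun x ↦ ?_)
      (fun _ ↦ 2 * K / n) fun i x x' ↦ ?_
    · exact abs_integral_le_of_abs_le fun y ↦ hC (x, y)
    · rw [← integral_sub (hint _) (hint _)]
      refine abs_integral_le_of_abs_le fun y ↦ (abs_norm_sub_norm_le _ _).trans ?_
      rw [sub_sub_sub_cancel_left, norm_sub_rev]
      exact norm_mean_update_sub_le hK i x x'
  · rw [← hpar L hm]
    refine hasSubgaussianMGF_pi_of_bounded_differences (fun _ ↦ ν)
      (hD.comp measurable_prodMk_left) (fun y ↦ hC (x, y)) (fun _ ↦ 2 * L / m) fun j y y' ↦ ?_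
    refine (abs_norm_sub_norm_le _ _).trans ?_
    rw [sub_sub_sub_cancel_right]
    simpa using norm_mean_update_sub_le hL j y y'

/-- Bound on the expected distance between the empirical means of two independent bounded samples
with the same expectation. -/
lemma integral_norm_mean_sub_mean_le [CompleteSpace H] (hg : Measurable g) (hh : Measurable h)
    (hK : ∀ x, ‖g x‖ ≤ K) (hL : ∀ y, ‖h y‖ ≤ L) (hgh : ∫ x, g x ∂μ = ∫ y, h y ∂ν)
    (hn : 0 < n) (hm : 0 < m) :
    ∫ ω, ‖(1 / (m : ℝ)) • ∑ j, h (ω.2 j) - (1 / (n : ℝ)) • ∑ i, g (ω.1 i)‖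
      ∂(Measure.pi fun _ : Fin n ↦ μ).prod (Measure.pi fun _ : Fin m ↦ ν) ≤
      Real.sqrt (K ^ 2 / n + L ^ 2 / m) := by
  set P := (Measure.pi fun _ : Fin n ↦ μ).prod (Measure.pi fun _ : Fin m ↦ ν)
  set v := ∫ x, g x ∂μ with hv
  have hgn : Measurable fun x : Fin n → X ↦ (1 / (n : ℝ)) • ∑ i, g (x i) := by fun_prop
  have hhm : Measurable fun y : Fin m → Y ↦ (1 / (m : ℝ)) • ∑ j, h (y j) := by fun_prop
  have ha : MemLp (fun x : Fin n → X ↦ v - (1 / (n : ℝ)) • ∑ i, g (x i)) 2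
      (Measure.pi fun _ ↦ μ) :=
    (memLp_const v).sub (MemLp.of_bound hgn.aestronglyMeasurable K (ae_of_all _ (norm_mean_le hK hn)))
  have hb₁ : MemLp (fun y : Fin m → Y ↦ (1 / (m : ℝ)) • ∑ j, h (y j)) 2
      (Measure.pi fun _ ↦ ν) :=
    MemLp.of_bound hhm.aestronglyMeasurable L (ae_of_all _ (norm_mean_le hL hm))
  have hb : MemLp (fun y : Fin m → Y ↦ (1 / (m : ℝ)) • ∑ j, h (y j) - v) 2
      (Measure.pi fun _ ↦ ν) := hb₁.sub (memLp_const v)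
  have hhL : MemLp h 2 ν := MemLp.of_bound hh.aestronglyMeasurable L (ae_of_all _ hL)
  have hb0 : ∫ y, ((1 / (m : ℝ)) • ∑ j, h (y j) - v) ∂(Measure.pi fun _ : Fin m ↦ ν) = 0 := by
    have hm' : (m : ℝ) ≠ 0 := by positivity
    have hhj (j : Fin m) : MemLp (fun y : Fin m → Y ↦ h (y j)) 2 (Measure.pi fun _ ↦ ν) :=
      hhL.comp_measurePreserving (measurePreserving_eval _ j)
    rw [integral_sub (hb₁.integrable one_le_two) (integrable_const _), integral_smul,
      integral_finsetSum _ fun j _ ↦ (hhj j).integrable one_le_two]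
    simp only [integral_comp_eval (μ := fun _ : Fin m ↦ ν) hhL.aestronglyMeasurable]
    simp [← hgh, ← Nat.cast_smul_eq_nsmul ℝ, smul_smul, hm']
  have hsq := integral_norm_add_sq_prod ha hb hb0
  have hD : MemLp (fun ω : (Fin n → X) × (Fin m → Y) ↦
      ‖(1 / (m : ℝ)) • ∑ j, h (ω.2 j) - (1 / (n : ℝ)) • ∑ i, g (ω.1 i)‖) 2 P :=
    MemLp.of_bound (by fun_prop) (L + K) (ae_of_all _ fun ω ↦ by
      rw [norm_norm]
      exact (norm_sub_le _ _).trans (add_le_add (norm_mean_le hL hm _) (norm_mean_le hK hn _)))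
  have hvarP := variance_nonneg (fun ω : (Fin n → X) × (Fin m → Y) ↦
      ‖(1 / (m : ℝ)) • ∑ j, h (ω.2 j) - (1 / (n : ℝ)) • ∑ i, g (ω.1 i)‖) P
  rw [variance_eq_sub hD] at hvarP
  refine Real.le_sqrt_of_sq_le ((sub_nonneg.1 hvarP).trans ?_)
  calc _ = _ := by
        refine integral_congr_ae (ae_of_all _ fun ω ↦ ?_)
        simp only [Pi.pow_apply]
        rw [← sub_add_sub_cancel' v]
    _ = _ := hsq
    _ ≤ _ := by
        gcongr
        · simp only [norm_sub_rev v]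
          exact integral_norm_mean_sub_sq_le μ hg.aestronglyMeasurable hK hn
        · rw [hgh]
          exact integral_norm_mean_sub_sq_le ν hh.aestronglyMeasurable hL hm

end TwoSample

/-- Hilbert-space concentration bound (Lemma 4 of Huang et al. 2006): for i.i.d.
samples `x₁,…,x_n ∼ p` and `x′₁,…,x′_m ∼ q`, where `dq = β·dp` with `0 ≤ β ≤ b₀` and
`‖φ(x)‖ ≤ R`, with probability at least `1 − δ`,
`‖(1/m)Σ_j φ(x′_j) − (1/n)Σ_i β(x_i)φ(x_i)‖ ≤ (1 + √(2 log(2/δ)))·R·√(b₀²/n + 1/m)`. -/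
theorem empirical_mean_concentration
    {H : Type*} [NormedAddCommGroup H] [InnerProductSpace ℝ H] [CompleteSpace H]
    [SecondCountableTopology H] [MeasurableSpace H] [BorelSpace H]
    {X : Type*} [MeasurableSpace X]
    (p q : Measure X) [IsProbabilityMeasure p] [IsProbabilityMeasure q]
    (β : X → ℝ) (hβmeas : Measurable β) (b₀ : ℝ) (hb₀ : 0 < b₀)
    (hβ : ∀ x, β x ∈ Set.Icc (0 : ℝ) b₀)
    (hq : q = p.withDensity fun x => ENNReal.ofReal (β x))
    (φ : X → H) (hφmeas : Measurable φ) (R : ℝ) (hR : 0 < R) (hφ : ∀ x, ‖φ x‖ ≤ R)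
    (n m : ℕ) (hn : 0 < n) (hm : 0 < m)
    (δ : ℝ) (hδ0 : 0 < δ) (hδ1 : δ < 1) :
    ENNReal.ofReal (1 - δ) ≤
      ((Measure.pi fun _ : Fin n => p).prod (Measure.pi fun _ : Fin m => q))
        {ω : (Fin n → X) × (Fin m → X) |
          ‖(1 / (m : ℝ)) • ∑ j : Fin m, φ (ω.2 j) -
              (1 / (n : ℝ)) • ∑ i : Fin n, β (ω.1 i) • φ (ω.1 i)‖ ≤
            (1 + Real.sqrt (2 * Real.log (2 / δ))) * R *
              Real.sqrt (b₀ ^ 2 / n + 1 / m)} := by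
  lift b₀ to ℝ≥0 using hb₀.le
  lift R to ℝ≥0 using hR.le
  have hb (x) : |β x| ≤ b₀ := abs_le.2 ⟨by linarith [(hβ x).1], (hβ x).2⟩
  have hK (x) : ‖β x • φ x‖ ≤ (b₀ * R : ℝ≥0) := by
    rw [norm_smul]
    exact mul_le_mul (hb x) (hφ x) (norm_nonneg _) hb₀.le
  have hmean : ∫ x, β x • φ x ∂p = ∫ x, φ x ∂q := by
    rw [hq, integral_withDensity_eq_integral_toReal_smul (by fun_prop) (by simp)]
    simp [ENNReal.toReal_ofReal (hβ _).1]
  have hg : Measurable fun x ↦ β x • φ x := hβmeas.smul hφmeas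
  have hsub := hasSubgaussianMGF_norm_mean_sub_mean (μ := p) (ν := q) hg hφmeas hK hφ hn hm
  have hE := integral_norm_mean_sub_mean_le (μ := p) (ν := q) hg hφmeas hK hφ hmean hn hm
  set P := (Measure.pi fun _ : Fin n ↦ p).prod (Measure.pi fun _ : Fin m ↦ q)
  set D : (Fin n → X) × (Fin m → X) → ℝ := fun ω ↦
    ‖(1 / (m : ℝ)) • ∑ j : Fin m, φ (ω.2 j) - (1 / (n : ℝ)) • ∑ i : Fin n, β (ω.1 i) • φ (ω.1 i)‖
  have hD : Measurable D := by fun_prop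
  set S := Real.sqrt (b₀ ^ 2 / n + 1 / m)
  have hSpos : 0 < S := Real.sqrt_pos.2 (by positivity)
  have hV : (b₀ * R) ^ 2 / n + R ^ 2 / m = (R * S) ^ 2 := by
    rw [mul_pow (R : ℝ), Real.sq_sqrt (by positivity)]
    ring
  have hlog : 0 ≤ Real.log (2 / δ) := Real.log_nonneg (by rw [le_div_iff₀ hδ0]; linarith)
  have hED : ∫ ω, D ω ∂P ≤ R * S := by
    refine hE.trans_eq ?_
    push_cast
    rw [hV, Real.sqrt_sq (by positivity)]
  set ε := Real.sqrt (2 * Real.log (2 / δ)) * (R * S) with hε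
  have htail := hsub.measure_ge_le (ε := ε) (by positivity)
  have hexp : Real.exp (-ε ^ 2 / (2 * ((b₀ * R) ^ 2 / n + R ^ 2 / m : ℝ≥0))) = δ / 2 := by
    push_cast
    rw [hV, hε, mul_pow, Real.sq_sqrt (by positivity),
      show -(2 * Real.log (2 / δ) * (R * S) ^ 2) / (2 * (R * S) ^ 2) = -Real.log (2 / δ) by
        field_simp, ← Real.log_inv, Real.exp_log (by positivity), inv_div]
  rw [hexp] at htail
  have hgood : MeasurableSet
      {ω | D ω ≤ (1 + Real.sqrt (2 * Real.log (2 / δ))) * R * S} :=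
    measurableSet_le hD measurable_const
  have hcompl : P.real {ω | D ω ≤ (1 + Real.sqrt (2 * Real.log (2 / δ))) * R * S}ᶜ ≤ δ / 2 := by
    refine (measureReal_mono fun ω hω ↦ ?_).trans htail
    simp only [Set.mem_compl_iff, Set.mem_ofPred_eq, not_le] at hω ⊢
    linarith
  rw [probReal_compl_eq_one_sub hgood] at hcompl
  refine ENNReal.ofReal_le_of_le_toReal ?_
  change 1 - δ ≤ P.real {ω | D ω ≤ (1 + Real.sqrt (2 * Real.log (2 / δ))) * R * S}
  linarith
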